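/- Let Γ be a non-elementary hyperbolic group and let d ∈ D_Γ be strongly hyperbolic. Then (#{g ∈ Γ : d(o,g) < T})^{−1} · #{g ∈ Γ : d(o,g) < T and |d(o,g) − ℓ_d[g]| > T^{1/3}} → 0 as T → ∞, where ℓ_d[g] denotes the translation length of g with respect to d. -/

import Mathlib

open Filter Set

namespace PaperCLT

variable {Γ : Type*} [Group Γ]

/-- Word length with respect to a generating set `S` (letters from `S ∪ S⁻¹`). -/
noncomputable def wordLength (S : Set Γ) (g : Γ) : ℕ :=
  sInf {n : ℕ | ∃ l : List Γ, l.length = n ∧ (∀ x ∈ l, x ∈ S ∪ S⁻¹) ∧ l.prod = g}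

/-- The word metric associated to a generating set `S`. -/
noncomputable def wordDist (S : Set Γ) (x y : Γ) : ℝ := (wordLength S (x⁻¹ * y) : ℝ)

/-- `S` is a finite generating set of `Γ`. -/
def GeneratingSet (S : Set Γ) : Prop := S.Finite ∧ Subgroup.closure S = ⊤

/-- `d` is a metric on `Γ`, viewed as a two-variable function. -/
structure IsMetric (d : Γ → Γ → ℝ) : Prop where
  refl : ∀ x, d x x = 0
  pos : ∀ x y, x ≠ y → 0 < d x y
  symm : ∀ x y, d x y = d y x
  triangle : ∀ x y z, d x z ≤ d x y + d y z

/-- The Gromov product `(x,y)_w`. -/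
noncomputable def gromov (d : Γ → Γ → ℝ) (w x y : Γ) : ℝ := (d w x + d w y - d x y) / 2

/-- Gromov hyperbolicity of a (pseudo)metric. -/
def IsGromovHyperbolic (d : Γ → Γ → ℝ) : Prop :=
  ∃ δ : ℝ, 0 ≤ δ ∧ ∀ x y z w : Γ, min (gromov d w x z) (gromov d w y z) - δ ≤ gromov d w x y

/-- `d'` is quasi-isometric to `d`. -/
def QuasiIsometric (d d' : Γ → Γ → ℝ) : Prop :=
  ∃ L > (0:ℝ), ∃ C ≥ (0:ℝ), ∀ x y : Γ,
    L⁻¹ * d x y - C ≤ d' x y ∧ d' x y ≤ L * d x y + C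

/-- `d ∈ 𝒟_Γ`: left-invariant, Gromov hyperbolic, quasi-isometric to a word metric. -/
structure MemD (d : Γ → Γ → ℝ) : Prop where
  isMetric : IsMetric d
  leftInvariant : ∀ g x y : Γ, d (g * x) (g * y) = d x y
  hyperbolic : IsGromovHyperbolic d
  quasiIsom : ∃ S : Set Γ, GeneratingSet S ∧ QuasiIsometric (wordDist S) d

/-- `Γ` is a hyperbolic group. -/
def IsHyperbolicGroup (Γ : Type*) [Group Γ] : Prop :=
  ∃ S : Set Γ, GeneratingSet S ∧ IsGromovHyperbolic (wordDist S)

/-- `Γ` is non-elementary: no cyclic subgroup of finite index. -/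
def NonElementary (Γ : Type*) [Group Γ] : Prop :=
  ¬ ∃ H : Subgroup Γ, H.FiniteIndex ∧ IsCyclic H

/-- `Γ` is virtually free: it has a free subgroup of finite index. -/
def VirtuallyFree (Γ : Type*) [Group Γ] : Prop :=
  ∃ H : Subgroup Γ, H.FiniteIndex ∧ Nonempty (IsFreeGroup H)

/-- Strong hyperbolicity of a metric. -/
def StronglyHyperbolic (d : Γ → Γ → ℝ) : Prop :=
  ∃ c > (0:ℝ), ∃ R₀ > (0:ℝ), ∀ R ≥ R₀, ∀ x x' y y' : Γ,
    R ≤ d x y - d x x' + d x' y' - d y y' →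
    |d x y - d x' y - d x y' + d x' y'| ≤ Real.exp (-c * R)

/-- Rough similarity of two metrics. -/
def RoughlySimilar (d d' : Γ → Γ → ℝ) : Prop :=
  ∃ Λ > (0:ℝ), ∃ C > (0:ℝ), ∀ g h : Γ, |d g h - Λ * d' g h| ≤ C

/-- The (stable) translation length `ℓ_d[g] = lim_n d(o,gⁿ)/n`. -/
noncomputable def translationLength (d : Γ → Γ → ℝ) (g : Γ) : ℝ :=
  limUnder atTop fun n : ℕ => d 1 (g ^ n) / n

/-- `d` has non-arithmetic length spectrum. -/
def NonArithmetic (d : Γ → Γ → ℝ) : Prop :=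
  ¬ ∃ a : ℝ, ∀ g : Γ, ∃ k : ℤ, translationLength d g = a * k

/-- The ball `{g : d(o,g) < T}`. -/
def ball (d : Γ → Γ → ℝ) (T : ℝ) : Set Γ := {g : Γ | d 1 g < T}

/-- The exponential growth rate `v_d`. -/
noncomputable def growthRate (d : Γ → Γ → ℝ) : ℝ :=
  limsup (fun T : ℝ => Real.log ((ball d T).ncard) / T) atTop

/-- `τ` is the mean distortion `τ(d⁎/d)`. -/
def IsMeanDistortion (d dst : Γ → Γ → ℝ) (τ : ℝ) : Prop :=
  Tendsto (fun T : ℝ => (((ball d T).ncard : ℝ))⁻¹ * ∑ᶠ g ∈ ball d T, dst 1 g / T)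
    atTop (nhds τ)

/-- `σ2` is the variance `σ²(d⁎/d)` (relative to the normalisation `τ`). -/
def IsVariance (d dst : Γ → Γ → ℝ) (τ σ2 : ℝ) : Prop :=
  Tendsto (fun T : ℝ => (((ball d T).ncard : ℝ))⁻¹ *
      ∑ᶠ g ∈ ball d T, (dst 1 g - τ * T) ^ 2 / T)
    atTop (nhds σ2)

/-- The distribution function `N_σ`: a centred Gaussian of standard deviation `σ > 0`,
and the point mass at `0` when `σ = 0`. -/
noncomputable def gaussCDF (σ t : ℝ) : ℝ :=
  if σ = 0 then (if t < 0 then 0 else 1)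
  else (Real.sqrt (2 * Real.pi) * σ)⁻¹ * ∫ u in Set.Iic t, Real.exp (-u ^ 2 / (2 * σ ^ 2))

end PaperCLT

namespace PaperCLT

variable {Γ : Type*} [Group Γ]

/-- Gromov product at the identity for a length function. -/
noncomputable def gp (N : Γ → ℝ) (x y : Γ) : ℝ := (N x + N y - N (x⁻¹ * y)) / 2

/-- A hyperbolic, proper, roughly geodesic length function. -/
structure HLen (N : Γ → ℝ) (δ K : ℝ) : Prop where
  one : N 1 = 0
  inv : ∀ x, N x⁻¹ = N x
  mul_le : ∀ x y, N (x * y) ≤ N x + N y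
  δpos : 0 < δ
  Kpos : 0 ≤ K
  hyp : ∀ x y z, min (gp N x z) (gp N z y) - δ ≤ gp N x y
  fin : ∀ T : ℝ, {g : Γ | N g < T}.Finite
  geo : ∀ g t, 0 ≤ t → t ≤ N g → ∃ a, |N a - t| ≤ K ∧ N a + N (a⁻¹ * g) ≤ N g + K

namespace HLen

variable {N : Γ → ℝ} {δ K : ℝ}

lemma nonneg (H : HLen N δ K) (x : Γ) : 0 ≤ N x := by
  have h := H.mul_le x x⁻¹
  rw [mul_inv_cancel, H.one, H.inv] at h
  linarith

lemma inv_mul_comm (H : HLen N δ K) (x y : Γ) : N (x⁻¹ * y) = N (y⁻¹ * x) := by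
  rw [← H.inv]; congr 1; group

lemma gp_symm (H : HLen N δ K) (x y : Γ) : gp N x y = gp N y x := by
  unfold gp; rw [H.inv_mul_comm]; ring

lemma gp_le (H : HLen N δ K) (x y : Γ) : gp N x y ≤ N x := by
  unfold gp
  have h := H.mul_le x (x⁻¹ * y)
  rw [mul_inv_cancel_left] at h
  linarith

lemma gp_le' (H : HLen N δ K) (x y : Γ) : gp N x y ≤ N y := by
  rw [H.gp_symm]; exact H.gp_le _ _

lemma gp_nonneg (H : HLen N δ K) (x y : Γ) : 0 ≤ gp N x y := by
  unfold gp
  have h := H.mul_le x⁻¹ y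
  rw [H.inv] at h
  linarith

lemma hyp2 (H : HLen N δ K) (x z y : Γ) :
    gp N x z ≤ gp N x y + δ ∨ gp N z y ≤ gp N x y + δ := by
  have h := H.hyp x y z
  rcases min_choice (gp N x z) (gp N z y) with h1 | h1 <;> rw [h1] at h
  · left; linarith
  · right; linarith

lemma hyp_lower (H : HLen N δ K) {x z y : Γ} {t : ℝ} (h1 : t ≤ gp N x z) (h2 : t ≤ gp N z y) :
    t - δ ≤ gp N x y := by
  have h := H.hyp x y z
  have := le_min h1 h2
  linarith

lemma hyp3 (H : HLen N δ K) (x z w y : Γ) :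
    gp N x z ≤ gp N x y + 2 * δ ∨ gp N z w ≤ gp N x y + 2 * δ ∨ gp N w y ≤ gp N x y + 2 * δ := by
  have := H.δpos
  rcases H.hyp2 x z y with h | h
  · left; linarith
  · rcases H.hyp2 z w y with h' | h'
    · right; left; linarith
    · right; right; linarith

lemma pow_step (H : HLen N δ K) (g : Γ) (n : ℕ) :
    N (g ^ (n + 1)) + (N (g ^ 2) - N g - 2 * δ) ≤ N (g ^ (n + 2)) ∨
    N (g ^ (n + 1)) + (N (g ^ 2) - N g - 2 * δ) ≤ N (g ^ n) := by
  have h := H.hyp2 g⁻¹ (g ^ (n + 1)) g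
  have e1 : (g⁻¹)⁻¹ * g ^ (n + 1) = g ^ (n + 2) := by rw [inv_inv, ← pow_succ']
  have e2 : (g⁻¹)⁻¹ * g = g ^ 2 := by rw [inv_inv, pow_two]
  have e3 : N ((g ^ (n + 1))⁻¹ * g) = N (g ^ n) := by
    rw [H.inv_mul_comm, pow_succ', inv_mul_cancel_left]
  unfold gp at h
  rw [e1, e2, e3, H.inv] at h
  rcases h with h | h
  · left; linarith
  · right; linarith

lemma pow_mono (H : HLen N δ K) (g : Γ) (hs : 0 < N (g ^ 2) - N g - 2 * δ) (n : ℕ) :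
    N (g ^ n) + (N (g ^ 2) - N g - 2 * δ) ≤ N (g ^ (n + 1)) := by
  induction n with
  | zero =>
    have h := H.mul_le g g
    rw [← pow_two] at h
    have := H.δpos
    simp only [pow_zero, zero_add, pow_one, H.one]
    linarith
  | succ n ih =>
    rcases H.pow_step g n with h | h
    · exact h
    · linarith

lemma pow_lower (H : HLen N δ K) (g : Γ) (n : ℕ) :
    n * (N (g ^ 2) - N g - 2 * δ) ≤ N (g ^ n) := by
  by_cases hs : 0 < N (g ^ 2) - N g - 2 * δ
  · induction n with
    | zero => simp [H.one]
    | succ n ih =>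
      have := H.pow_mono g hs n
      push_cast
      linarith
  · push Not at hs
    have := H.nonneg (g ^ n)
    have : (n : ℝ) * (N (g ^ 2) - N g - 2 * δ) ≤ 0 :=
      mul_nonpos_of_nonneg_of_nonpos (Nat.cast_nonneg n) hs
    linarith

/-- Loxodromic-type condition. -/
def Lox (N : Γ → ℝ) (δ : ℝ) (g : Γ) : Prop := N g + 4 * δ ≤ N (g ^ 2)

lemma lox_inv (H : HLen N δ K) {g : Γ} (h : Lox N δ g) : Lox N δ g⁻¹ := by
  unfold Lox at *
  rw [inv_pow, H.inv, H.inv]; exact h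

lemma lox_lower (H : HLen N δ K) {g : Γ} (h : Lox N δ g) (n : ℕ) : n * (2 * δ) ≤ N (g ^ n) := by
  have h1 := H.pow_lower g n
  unfold Lox at h
  have : (n : ℝ) * (2 * δ) ≤ n * (N (g ^ 2) - N g - 2 * δ) :=
    mul_le_mul_of_nonneg_left (by linarith) (Nat.cast_nonneg n)
  linarith

lemma lox_gp (H : HLen N δ K) {g : Γ} (h : Lox N δ g) (n m : ℕ) :
    gp N (g ^ n) (g⁻¹ ^ m) ≤ N g / 2 + δ := by
  have hδ := H.δpos
  unfold Lox at h
  have hg := H.nonneg g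
  rcases Nat.eq_zero_or_pos n with rfl | hn
  · have := H.gp_le (g ^ 0) (g⁻¹ ^ m)
    rw [pow_zero, H.one] at this
    rw [pow_zero]; linarith
  rcases Nat.eq_zero_or_pos m with rfl | hm
  · have := H.gp_le' (g ^ n) (g⁻¹ ^ 0)
    rw [pow_zero, H.one] at this
    rw [pow_zero]; linarith
  obtain ⟨n, rfl⟩ : ∃ k, n = k + 1 := ⟨n - 1, by omega⟩
  obtain ⟨m, rfl⟩ : ∃ k, m = k + 1 := ⟨m - 1, by omega⟩
  have hs : 0 < N (g ^ 2) - N g - 2 * δ := by linarith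
  have key : ∀ n, (N g + (N (g ^ 2) - N g - 2 * δ)) / 2 ≤ gp N g (g ^ (n + 1)) := by
    intro n
    have h1 := H.pow_mono g hs n
    unfold gp
    rw [pow_succ' g n, inv_mul_cancel_left, ← pow_succ' g n]
    linarith
  have key' : ∀ n, (N g + (N (g ^ 2) - N g - 2 * δ)) / 2 ≤ gp N (g⁻¹ ^ (n + 1)) g⁻¹ := by
    intro n
    have h1 := H.pow_mono g hs n
    rw [H.gp_symm]
    unfold gp
    rw [pow_succ' g⁻¹ n, inv_mul_cancel_left, ← pow_succ' g⁻¹ n, inv_pow, inv_pow, H.inv, H.inv,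
      H.inv]
    linarith
  have e : gp N g g⁻¹ = (2 * N g - N (g ^ 2)) / 2 := by
    unfold gp
    rw [← mul_inv_rev, H.inv, H.inv, ← pow_two]; ring
  have k1 := key n
  have k2 := key' m
  rcases H.hyp3 g (g ^ (n + 1)) (g⁻¹ ^ (m + 1)) g⁻¹ with h1 | h1 | h1 <;> rw [e] at h1 <;> linarith

/-- Discrete intermediate value theorem. -/
lemma divt (f : ℕ → ℝ) (C : ℝ) (hC : 0 ≤ C) (n : ℕ) (h0 : f 0 ≤ 0) (hf : ∀ i < n, |f (i + 1) - f i| ≤ C)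
    (t : ℝ) (ht0 : 0 ≤ t) (ht : t ≤ f n) : ∃ i ≤ n, t ≤ f i ∧ f i ≤ t + C := by
  induction n with
  | zero => exact ⟨0, le_rfl, ht, by linarith⟩
  | succ n ih =>
    by_cases h : t ≤ f n
    · obtain ⟨i, hi, h1⟩ := ih (fun i hi => hf i (by omega)) h
      exact ⟨i, by omega, h1⟩
    · push Not at h
      have := (abs_le.1 (hf n (by omega))).2
      exact ⟨n + 1, le_rfl, ht, by linarith⟩

lemma lox_path (H : HLen N δ K) {g : Γ} (h : Lox N δ g) (n : ℕ) (t : ℝ) (ht0 : 0 ≤ t)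
    (ht : t ≤ N (g ^ n)) :
    ∃ i ≤ n, t ≤ N (g ^ i) ∧ N (g ^ i) ≤ t + N g ∧ t - (N g / 2 + δ) ≤ gp N (g ^ i) (g ^ n) := by
  obtain ⟨i, hi, h1, h2⟩ := divt (fun i => N (g ^ i)) (N g) (H.nonneg g) n
    (by simp [H.one]) (by
      intro i _
      have h1 := H.mul_le (g ^ i) g
      have h2 := H.mul_le (g ^ (i + 1)) g⁻¹
      rw [← pow_succ] at h1
      rw [pow_succ, mul_inv_cancel_right, H.inv, ← pow_succ] at h2
      rw [abs_le]; constructor <;> linarith) t ht0 ht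
  refine ⟨i, hi, h1, h2, ?_⟩
  have h3 := H.lox_gp h (n - i) i
  obtain ⟨k, rfl⟩ : ∃ k, n = i + k := ⟨n - i, by omega⟩
  have e1 : i + k - i = k := by omega
  rw [e1] at h3
  unfold gp at *
  have e2 : N ((g ^ k)⁻¹ * g⁻¹ ^ i) = N (g ^ (i + k)) := by
    rw [inv_pow, ← mul_inv_rev, H.inv, ← pow_add]
  rw [e2, inv_pow, H.inv] at h3
  rw [pow_add, inv_mul_cancel_left, ← pow_add]
  linarith

lemma gp_right_mul (H : HLen N δ K) (x y : Γ) : N x - N y ≤ gp N x (x * y) := by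
  unfold gp
  rw [inv_mul_cancel_left]
  have := H.mul_le (x * y) y⁻¹
  rw [mul_inv_cancel_right, H.inv] at this
  linarith

/-- Base point change. -/
lemma gp_base (H : HLen N δ K) (y u v : Γ) : |gp N (y * u) (y * v) - gp N u v| ≤ N y := by
  unfold gp
  have e : (y * u)⁻¹ * (y * v) = u⁻¹ * v := by group
  rw [e]
  have h1 := H.mul_le y u
  have h2 := H.mul_le y v
  have h3 := H.mul_le y⁻¹ (y * u)
  have h4 := H.mul_le y⁻¹ (y * v)
  rw [inv_mul_cancel_left, H.inv] at h3 h4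
  rw [abs_le]; constructor <;> linarith

/-- Changing the second end point. -/
lemma gp_end (H : HLen N δ K) (x u y : Γ) : gp N x (u * y) ≤ gp N x u + N y := by
  unfold gp
  have h1 := H.mul_le u y
  have h2 := H.mul_le (x⁻¹ * (u * y)) y⁻¹
  have e : x⁻¹ * (u * y) * y⁻¹ = x⁻¹ * u := by group
  rw [e, H.inv] at h2
  linarith

lemma exists_lox (H : HLen N δ K) [Infinite Γ] : ∃ g : Γ, Lox N δ g := by
  have hδ := H.δpos
  have hK := H.Kpos
  obtain ⟨x, hx⟩ : ∃ x : Γ, 100 * (K + δ) ≤ N x := by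
    by_contra! hcon
    have := H.fin (100 * (K + δ))
    rw [show {g : Γ | N g < 100 * (K + δ)} = Set.univ from Set.eq_univ_of_forall hcon] at this
    exact Set.infinite_univ this
  obtain ⟨p, hp1, hp2⟩ := H.geo x (N x / 2) (by linarith) (by linarith)
  rw [abs_le] at hp1
  have h3 := H.mul_le p (p⁻¹ * x)
  rw [mul_inv_cancel_left] at h3
  obtain ⟨a, ha⟩ : ∃ a, a = p⁻¹ := ⟨_, rfl⟩
  obtain ⟨b, hb⟩ : ∃ b, b = p⁻¹ * x := ⟨_, rfl⟩
  have hNa : N a = N p := by rw [ha, H.inv]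
  have hNab : N (a⁻¹ * b) = N x := by rw [ha, hb]; congr 1; group
  rw [← hNa, ← hb] at hp2 h3
  rw [← hNa] at hp1
  have hab : gp N a b ≤ K / 2 := by unfold gp; rw [hNab]; linarith
  by_cases la : Lox N δ a
  · exact ⟨a, la⟩
  by_cases lb : Lox N δ b
  · exact ⟨b, lb⟩
  refine ⟨a * b, ?_⟩
  unfold Lox at la lb ⊢
  push Not at la lb
  have e : ∀ g, gp N g g⁻¹ = (2 * N g - N (g ^ 2)) / 2 := by
    intro g
    unfold gp
    rw [← mul_inv_rev, H.inv, H.inv, ← pow_two]; ring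
  have ea := e a
  have eb := e b
  have eab := e (a * b)
  have h1 : gp N a⁻¹ b ≤ K / 2 + δ := by
    rcases H.hyp2 a a⁻¹ b with h | h <;> linarith
  have h2 : gp N a b⁻¹ ≤ K / 2 + δ := by
    rcases H.hyp2 a b⁻¹ b with h | h
    · linarith
    · rw [H.gp_symm] at h; linarith
  have h4 : N (a * b) = N a + N b - 2 * gp N a⁻¹ b := by
    unfold gp; rw [inv_inv, H.inv]; ring
  have h5 : gp N a (a * b) = (N a + N (a * b) - N b) / 2 := by
    unfold gp; rw [inv_mul_cancel_left]
  have h6 : gp N (a * b)⁻¹ b⁻¹ = (N b + N (a * b) - N a) / 2 := by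
    unfold gp; rw [inv_inv, mul_inv_cancel_right, H.inv, H.inv]; ring
  rcases H.hyp3 a (a * b) (a * b)⁻¹ b⁻¹ with h | h | h <;> linarith

lemma lox_zpow_ne (H : HLen N δ K) {g : Γ} (h : Lox N δ g) {q : ℤ} (hq : q ≠ 0) : g ^ q ≠ 1 := by
  intro h1
  have hδ := H.δpos
  have h2 : N (g ^ q.natAbs) = 0 := by
    rcases Int.natAbs_eq q with h3 | h3
    · rw [h3, zpow_natCast] at h1; rw [h1, H.one]
    · rw [h3, zpow_neg, zpow_natCast, inv_eq_one] at h1; rw [h1, H.one]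
  have h3 := H.lox_lower h q.natAbs
  have h4 : (0 : ℝ) < q.natAbs := by exact_mod_cast Int.natAbs_pos.2 hq
  have : 0 < (q.natAbs : ℝ) * (2 * δ) := by positivity
  linarith

/-- If the orbits of two loxodromics share an end, they are commensurate. -/
lemma pigeon (H : HLen N δ K) {g h : Γ} (hg : Lox N δ g) (hh : Lox N δ h) (y : Γ)
    (hu : ∀ t : ℝ, ∃ i j : ℕ, t ≤ gp N (g ^ i) (y * h ^ j)) :
    ∃ p q : ℤ, p ≠ 0 ∧ q ≠ 0 ∧ y * h ^ p = g ^ q * y := by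
  have hδ := H.δpos
  have hy := H.nonneg y
  have hgn := H.nonneg g
  have hhn := H.nonneg h
  set R : ℝ := 10 * (N y + N g + N h + δ) + 1 with hR
  have step : ∀ t : ℝ, N y ≤ t → ∃ i j : ℕ, t ≤ N (g ^ i) ∧ N ((g ^ i)⁻¹ * (y * h ^ j)) < R := by
    intro t ht
    obtain ⟨i, j, hij⟩ := hu t
    obtain ⟨i', -, hi1, hi2, hi3⟩ := H.lox_path hg i t (by linarith) (hij.trans (H.gp_le _ _))
    have h1 := H.gp_le' (g ^ i) (y * h ^ j)
    have h2 := H.mul_le y (h ^ j)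
    obtain ⟨j', -, hj1, hj2, hj3⟩ := H.lox_path hh j (t - N y) (by linarith) (by linarith)
    have h3 := (abs_le.1 (H.gp_base y (h ^ j') (h ^ j))).1
    have h4 : t - (2 * N y + N g + N h + 2 * δ) ≤ gp N (g ^ i') (g ^ i) := by linarith
    have h5 : t - (2 * N y + N g + N h + 2 * δ) ≤ gp N (g ^ i) (y * h ^ j') := by
      have h8 : t - (2 * N y + N h + δ) ≤ gp N (g ^ i) (y * h ^ j) := by linarith
      have h9 : t - (2 * N y + N h + δ) ≤ gp N (y * h ^ j) (y * h ^ j') := by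
        rw [H.gp_symm]; linarith
      have := H.hyp_lower h8 h9
      linarith
    have h6 := H.hyp_lower h4 h5
    have h7 := H.mul_le y (h ^ j')
    refine ⟨i', j', hi1, ?_⟩
    unfold gp at h6
    linarith
  have hinf : {i : ℕ | ∃ j : ℕ, N ((g ^ i)⁻¹ * (y * h ^ j)) < R}.Infinite := by
    intro hfin
    obtain ⟨B, hB⟩ := (hfin.image (fun i => N (g ^ i))).bddAbove
    obtain ⟨i, j, h1, h2⟩ := step (max (N y) (B + 1)) (le_max_left _ _)
    have h3 := hB (Set.mem_image_of_mem (fun i => N (g ^ i)) (show i ∈ {i : ℕ | _} from ⟨j, h2⟩))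
    have h4 := le_max_right (N y) (B + 1)
    linarith
  choose! J hJ using fun (i : ℕ) (hi : i ∈ {i : ℕ | ∃ j : ℕ, N ((g ^ i)⁻¹ * (y * h ^ j)) < R}) => hi
  obtain ⟨i, hi, i', hi', hne, heq⟩ := hinf.exists_ne_map_eq_of_mapsTo
    (f := fun i => (g ^ i)⁻¹ * (y * h ^ J i)) (t := {g : Γ | N g < R}) (fun i hi => hJ i hi) (H.fin R)
  have e1 : y * h ^ ((J i : ℤ) - J i') = g ^ ((i : ℤ) - i') * y := by
    have e2 : y * h ^ J i = g ^ i * ((g ^ i')⁻¹ * (y * h ^ J i')) := by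
      rw [← heq, mul_inv_cancel_left]
    rw [zpow_sub, zpow_sub, zpow_natCast, zpow_natCast, zpow_natCast, zpow_natCast, ← mul_assoc, e2]
    group
  refine ⟨(J i : ℤ) - J i', (i : ℤ) - i', ?_, by omega, e1⟩
  intro h0
  rw [h0, zpow_zero, mul_one, right_eq_mul] at e1
  exact H.lox_zpow_ne hg (by omega) e1

lemma zpow_natAbs (H : HLen N δ K) (g : Γ) (q : ℤ) : N (g ^ q) = N (g ^ q.natAbs) := by
  rcases Int.natAbs_eq q with h | h
  · conv_lhs => rw [h, zpow_natCast]
  · conv_lhs => rw [h, zpow_neg, zpow_natCast, H.inv]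

lemma lox_gp_z (H : HLen N δ K) {g : Γ} (h : Lox N δ g) (m : ℤ) :
    gp N (g ^ m) (g ^ (-m)) ≤ N g / 2 + δ := by
  rcases Int.natAbs_eq m with h1 | h1
  · rw [h1, zpow_neg, zpow_natCast, ← inv_pow]; exact H.lox_gp h _ _
  · rw [h1, neg_neg, H.gp_symm, zpow_neg, zpow_natCast, ← inv_pow]; exact H.lox_gp h _ _

lemma near (H : HLen N δ K) {g : Γ} (hg : Lox N δ g) (y : Γ) (p : ℤ) (q : ℕ) (hp : p ≠ 0)
    (hc : y * g ^ p = g ^ (q : ℤ) * y) :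
    ∃ j : ℤ, N (y⁻¹ * g ^ j) < 10 * (N g + δ) := by
  have hδ := H.δpos
  have hgn := H.nonneg g
  have hyn := H.nonneg y
  obtain ⟨k, hk⟩ := exists_nat_gt ((N y + N g + 10 * δ) / (2 * δ))
  rw [div_lt_iff₀ (by linarith)] at hk
  have hk0 : 0 ≤ k * (2 * δ) := by positivity
  set n : ℕ := q * k with hn
  set m : ℤ := p * k with hm
  have hck : ∀ s : ℤ, y * g ^ (p * s) = g ^ ((q : ℤ) * s) * y := by
    intro s
    have : SemiconjBy y (g ^ p) (g ^ (q : ℤ)) := hc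
    have := this.zpow_right s
    rw [← zpow_mul, ← zpow_mul] at this
    exact this
  have c1 : y⁻¹ * g ^ n = g ^ m * y⁻¹ := by
    have := hck k
    rw [← hm, show (q : ℤ) * k = (n : ℤ) by rw [hn]; push_cast; ring, zpow_natCast] at this
    rw [eq_mul_inv_iff_mul_eq, mul_assoc, ← this, inv_mul_cancel_left]
  have c2 : y⁻¹ * (g ^ n)⁻¹ = g ^ (-m) * y⁻¹ := by
    have := hck (-k)
    rw [show p * -(k : ℤ) = -m by rw [hm]; ring,
      show (q : ℤ) * (-k) = -(n : ℤ) by rw [hn]; push_cast; ring, zpow_neg _ (n : ℤ),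
      zpow_natCast] at this
    rw [eq_mul_inv_iff_mul_eq, mul_assoc, ← this, inv_mul_cancel_left]
  have big : N y + N g + 10 * δ ≤ N (g ^ m) := by
    rw [H.zpow_natAbs]
    have h1 := H.lox_lower hg m.natAbs
    have h2 : (k : ℝ) ≤ (m.natAbs : ℝ) := by
      have : k ≤ m.natAbs := by
        rw [hm, Int.natAbs_mul, Int.natAbs_natCast]
        exact Nat.le_mul_of_pos_left _ (Int.natAbs_pos.2 hp)
      exact_mod_cast this
    have h3 : (k : ℝ) * (2 * δ) ≤ m.natAbs * (2 * δ) := mul_le_mul_of_nonneg_right h2 (by linarith)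
    linarith
  have big' : N (g ^ (-m)) = N (g ^ m) := by rw [zpow_neg, H.inv]
  have g1 := H.gp_right_mul (g ^ m) y⁻¹
  have g2 := H.gp_right_mul (g ^ (-m)) y⁻¹
  have g3 := H.lox_gp_z hg m
  rw [H.inv] at g1 g2
  have key : gp N (y⁻¹ * g ^ n) (y⁻¹ * (g ^ n)⁻¹) ≤ N g / 2 + 3 * δ := by
    rw [c1, c2]
    rcases H.hyp3 (g ^ m) (g ^ m * y⁻¹) (g ^ (-m) * y⁻¹) (g ^ (-m)) with h | h | h
    · linarith
    · linarith
    · rw [H.gp_symm] at h; linarith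
  set u := g ^ n * y with hu
  set t := gp N u (g ^ (2 * n)) with ht
  obtain ⟨i, hi, h1, h2, h3⟩ := H.lox_path hg (2 * n) t (H.gp_nonneg _ _) (H.gp_le' _ _)
  have h4 : t - (N g / 2 + δ) ≤ gp N u (g ^ (2 * n)) := by linarith
  have h3' : t - (N g / 2 + δ) ≤ gp N (g ^ (2 * n)) (g ^ i) := by rw [H.gp_symm]; exact h3
  have h5 := H.hyp_lower h4 h3'
  have h6 : N u - t = gp N (y⁻¹ * g ^ n) (y⁻¹ * (g ^ n)⁻¹) := by
    have e1 : (y⁻¹ * g ^ n)⁻¹ * (y⁻¹ * (g ^ n)⁻¹) = (g ^ (2 * n))⁻¹ := by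
      rw [two_mul, pow_add]; group
    have e2 : y⁻¹ * (g ^ n)⁻¹ = u⁻¹ := by rw [hu]; group
    have e3 : u⁻¹ * g ^ (2 * n) = y⁻¹ * g ^ n := by rw [hu, two_mul, pow_add]; group
    rw [ht]
    unfold gp
    rw [e1, e2, e3, H.inv, H.inv]; ring
  refine ⟨(i : ℤ) - n, ?_⟩
  have e4 : y⁻¹ * g ^ ((i : ℤ) - n) = u⁻¹ * g ^ i := by
    rw [hu, mul_inv_rev, mul_assoc, sub_eq_neg_add, zpow_add, zpow_neg, zpow_natCast, zpow_natCast]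
  rw [e4]
  unfold gp at h5
  linarith

/-- Three independent long elements give uniform doubling. -/
lemma doubling_of_three (H : HLen N δ K) [DecidableEq Γ] (e : Fin 3 → Γ) (C : ℝ)
    (h1 : ∀ i j, i ≠ j → gp N (e i) (e j) ≤ C)
    (h2 : ∀ i j, i ≠ j → gp N (e i)⁻¹ (e j)⁻¹ ≤ C)
    (h3 : ∀ i, 2 * C + 2 * δ < N (e i)) (X : Finset Γ) :
    2 * X.card ≤ (X.biUnion fun g => Finset.univ.image fun i => g * e i).card := by
  classical
  set P : Finset (Γ × Fin 3) :=
    (X ×ˢ Finset.univ).filter fun p => gp N p.1⁻¹ (e p.2) ≤ C + δ with hP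
  have hcard : 2 * X.card ≤ P.card := by
    have hfib : ∀ g ∈ X, 2 ≤ (P.filter fun p => p.1 = g).card := by
      intro g hg
      have : ∃ i j : Fin 3, i ≠ j ∧ gp N g⁻¹ (e i) ≤ C + δ ∧ gp N g⁻¹ (e j) ≤ C + δ := by
        have hh : ∀ i j, i ≠ j → gp N g⁻¹ (e i) ≤ C + δ ∨ gp N g⁻¹ (e j) ≤ C + δ := by
          intro i j hij
          have := h1 i j hij
          rcases H.hyp2 (e i) g⁻¹ (e j) with h | h
          · left; rw [H.gp_symm]; linarith
          · right; linarith
        rcases hh 0 1 (by decide) with a | a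
        · rcases hh 1 2 (by decide) with b | b
          · exact ⟨0, 1, by decide, a, b⟩
          · exact ⟨0, 2, by decide, a, b⟩
        · rcases hh 0 2 (by decide) with b | b
          · exact ⟨1, 0, by decide, a, b⟩
          · exact ⟨1, 2, by decide, a, b⟩
      obtain ⟨i, j, hij, hi, hj⟩ := this
      rw [← Finset.card_pair (show (g, i) ≠ (g, j) by simpa using hij)]
      apply Finset.card_le_card
      intro p hp
      simp only [Finset.mem_insert, Finset.mem_singleton] at hp
      rcases hp with rfl | rfl <;> simp [hP, hg, hi, hj]
    have := Finset.card_nsmul_le_sum X _ 2 hfib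
    rw [← Finset.card_eq_sum_card_fiberwise (f := Prod.fst) (s := P) (t := X)
      (fun p hp => by
        have hp' : p ∈ P := hp
        simp only [hP, Finset.mem_filter, Finset.mem_product] at hp'
        exact hp'.1.1)] at this
    simpa [mul_comm] using this
  refine hcard.trans (Finset.card_le_card_of_injOn (fun p => p.1 * e p.2) ?_ ?_)
  · intro p hp
    have hp' : p ∈ P := hp
    simp only [hP, Finset.mem_filter, Finset.mem_product] at hp'
    simp only [Finset.coe_biUnion, Set.mem_iUnion, Finset.mem_coe, Finset.mem_image]
    exact ⟨p.1, hp'.1.1, p.2, Finset.mem_univ _, rfl⟩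
  · rintro ⟨g, i⟩ hp ⟨g', j⟩ hp' heq
    have hp1 : (g, i) ∈ P := hp
    have hp2 : (g', j) ∈ P := hp'
    simp only [hP, Finset.mem_filter, Finset.mem_product] at hp1 hp2
    simp only at heq
    have e1 : ∀ (g : Γ) i, gp N (g * e i)⁻¹ (e i)⁻¹ = N (e i) - gp N g⁻¹ (e i) := by
      intro g i
      unfold gp
      rw [inv_inv, mul_inv_cancel_right, inv_inv, H.inv, H.inv, H.inv]; ring
    by_cases hij : i = j
    · subst hij
      rw [mul_right_cancel heq]
    · exfalso
      have k1 := e1 g i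
      have k2 := e1 g' j
      rw [← heq] at k2
      have k3 := h3 i
      have k4 := h3 j
      have k5 := h2 i j hij
      rcases H.hyp2 (e i)⁻¹ (g * e i)⁻¹ (e j)⁻¹ with h | h
      · rw [H.gp_symm] at h; linarith [hp1.2]
      · linarith [hp2.2]

lemma near' (H : HLen N δ K) {g : Γ} (hg : Lox N δ g) (y : Γ)
    (h : ∃ p q : ℤ, p ≠ 0 ∧ q ≠ 0 ∧ y * g ^ p = g ^ q * y) :
    ∃ j : ℤ, N (y⁻¹ * g ^ j) < 10 * (N g + δ) := by
  obtain ⟨p, q, hp, hq, hc⟩ := h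
  rcases Int.natAbs_eq q with h1 | h1
  · rw [h1] at hc
    exact H.near hg y p _ hp hc
  · refine H.near hg y (-p) q.natAbs (by omega) ?_
    have h2 : SemiconjBy y (g ^ p) (g ^ q) := hc
    have h3 := h2.inv_right
    rw [← zpow_neg, ← zpow_neg] at h3
    rw [show (q.natAbs : ℤ) = -q by omega]
    exact h3

lemma finiteIndex_of_near (H : HLen N δ K) (g : Γ) (D : ℝ)
    (h : ∀ y : Γ, ∃ j : ℤ, N (y⁻¹ * g ^ j) < D) : (Subgroup.zpowers g).FiniteIndex := by
  have hfin := H.fin D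
  have : Finite (Γ ⧸ Subgroup.zpowers g) := by
    have hs : (QuotientGroup.mk '' {x : Γ | N x < D} : Set (Γ ⧸ Subgroup.zpowers g)) = Set.univ := by
      apply Set.eq_univ_of_forall
      intro z
      obtain ⟨x, rfl⟩ := QuotientGroup.mk_surjective z
      obtain ⟨j, hj⟩ := h x⁻¹
      rw [inv_inv] at hj
      refine ⟨x * g ^ j, hj, ?_⟩
      rw [QuotientGroup.eq]
      exact ⟨-j, by simp only [zpow_neg]; group⟩
    rw [← Set.finite_univ_iff, ← hs]
    exact hfin.image _
  exact Subgroup.finiteIndex_of_finite_quotient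

lemma exists_three (H : HLen N δ K) (hNE : NonElementary Γ) :
    ∃ (e : Fin 3 → Γ) (C : ℝ), (∀ i j, i ≠ j → gp N (e i) (e j) ≤ C) ∧
      (∀ i j, i ≠ j → gp N (e i)⁻¹ (e j)⁻¹ ≤ C) ∧ (∀ i, 2 * C + 2 * δ < N (e i)) := by
  have hδ := H.δpos
  have : Infinite Γ := by
    by_contra hfin
    rw [not_infinite_iff_finite] at hfin
    exact hNE ⟨⊥, inferInstance, inferInstance⟩
  obtain ⟨g, hg⟩ := H.exists_lox
  have hg' := H.lox_inv hg
  obtain ⟨y, hy⟩ : ∃ y : Γ, ¬ ∃ p q : ℤ, p ≠ 0 ∧ q ≠ 0 ∧ y * g ^ p = g ^ q * y := by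
    by_contra! hcon
    exact hNE ⟨Subgroup.zpowers g,
      H.finiteIndex_of_near g _ (fun y => H.near' hg y (hcon y)), inferInstance⟩
  have b1 : ∃ t : ℝ, ∀ i j : ℕ, gp N (g ^ i) (y * g ^ j) < t := by
    by_contra! hcon
    exact hy (H.pigeon hg hg y hcon)
  have b2 : ∃ t : ℝ, ∀ i j : ℕ, gp N (g ^ i) (y * g⁻¹ ^ j) < t := by
    by_contra! hcon
    obtain ⟨p, q, hp, hq, hc⟩ := H.pigeon hg hg' y hcon
    exact hy ⟨-p, q, by omega, hq, by rw [zpow_neg, ← inv_zpow]; exact hc⟩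
  have b3 : ∃ t : ℝ, ∀ i j : ℕ, gp N (g⁻¹ ^ i) (y * g ^ j) < t := by
    by_contra! hcon
    obtain ⟨p, q, hp, hq, hc⟩ := H.pigeon hg' hg y hcon
    exact hy ⟨p, -q, hp, by omega, by rw [zpow_neg, ← inv_zpow]; exact hc⟩
  have b4 : ∃ t : ℝ, ∀ i j : ℕ, gp N (g⁻¹ ^ i) (y * g⁻¹ ^ j) < t := by
    by_contra! hcon
    obtain ⟨p, q, hp, hq, hc⟩ := H.pigeon hg' hg' y hcon
    exact hy ⟨-p, -q, by omega, by omega, by rw [zpow_neg, ← inv_zpow, zpow_neg, ← inv_zpow]; exact hc⟩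
  obtain ⟨t1, b1⟩ := b1
  obtain ⟨t2, b2⟩ := b2
  obtain ⟨t3, b3⟩ := b3
  obtain ⟨t4, b4⟩ := b4
  have hyn := H.nonneg y
  have hgn := H.nonneg g
  set C : ℝ := |t1| + |t2| + |t3| + |t4| + N y + N g + δ with hC
  have a1 := le_abs_self t1
  have a2 := le_abs_self t2
  have a3 := le_abs_self t3
  have a4 := le_abs_self t4
  have a1' := abs_nonneg t1
  have a2' := abs_nonneg t2
  have a3' := abs_nonneg t3
  have a4' := abs_nonneg t4
  obtain ⟨n, hn⟩ := exists_nat_gt ((2 * C + 2 * δ + 2 * N y) / (2 * δ))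
  rw [div_lt_iff₀ (by linarith)] at hn
  have hlow := H.lox_lower hg n
  have c0 := H.lox_gp hg n n
  have key : ∀ u v : Γ, gp N u (y * v) ≤ |t1| + |t2| + |t3| + |t4| → gp N u (y * v * y⁻¹) ≤ C := by
    intro u v huv
    have := H.gp_end u (y * v) y⁻¹
    rw [H.inv] at this
    linarith
  have k1 := key _ _ (show gp N (g ^ n) (y * g ^ n) ≤ _ by linarith [b1 n n])
  have k2 := key _ _ (show gp N (g ^ n) (y * g⁻¹ ^ n) ≤ _ by linarith [b2 n n])
  have k3 := key _ _ (show gp N (g⁻¹ ^ n) (y * g ^ n) ≤ _ by linarith [b3 n n])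
  have k4 := key _ _ (show gp N (g⁻¹ ^ n) (y * g⁻¹ ^ n) ≤ _ by linarith [b4 n n])
  have k0 : gp N (g ^ n) (g⁻¹ ^ n) ≤ C := by linarith
  have e1 : (g ^ n)⁻¹ = g⁻¹ ^ n := by rw [inv_pow]
  have e2 : (g⁻¹ ^ n)⁻¹ = g ^ n := by rw [inv_pow, inv_inv]
  have e3 : (y * g ^ n * y⁻¹)⁻¹ = y * g⁻¹ ^ n * y⁻¹ := by rw [inv_pow]; group
  have hsymm : ∀ u v, gp N u v ≤ C → gp N v u ≤ C := fun u v h => by rw [H.gp_symm]; exact h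
  refine ⟨![g ^ n, g⁻¹ ^ n, y * g ^ n * y⁻¹], C, ?_, ?_, ?_⟩
  · intro i j hij
    fin_cases i <;> fin_cases j <;> simp only [Fin.zero_eta, Fin.mk_one, Fin.reduceFinMk,
      Matrix.cons_val, ne_eq, not_true_eq_false] at hij ⊢ <;>
      first | assumption | (apply hsymm; assumption)
  · intro i j hij
    fin_cases i <;> fin_cases j <;> simp only [Fin.zero_eta, Fin.mk_one, Fin.reduceFinMk,
      Matrix.cons_val, ne_eq, not_true_eq_false, e1, e2, e3] at hij ⊢ <;>
      first | assumption | (apply hsymm; assumption)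
  · have h5 : N (g ^ n) - 2 * N y ≤ N (y * g ^ n * y⁻¹) := by
      have h6 := H.mul_le (y⁻¹ * (y * g ^ n * y⁻¹)) y
      have h7 := H.mul_le y⁻¹ (y * g ^ n * y⁻¹)
      rw [show y⁻¹ * (y * g ^ n * y⁻¹) * y = g ^ n by group] at h6
      rw [H.inv] at h7
      linarith
    have h8 : N (g⁻¹ ^ n) = N (g ^ n) := by rw [inv_pow, H.inv]
    intro i
    fin_cases i <;> simp only [Fin.zero_eta, Fin.mk_one, Fin.reduceFinMk, Matrix.cons_val] <;> linarith

lemma doubling (H : HLen N δ K) (hNE : NonElementary Γ) :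
    ∃ M > (0:ℝ), ∀ T : ℝ, 2 * {g : Γ | N g < T}.ncard ≤ {g : Γ | N g < T + M}.ncard := by
  classical
  obtain ⟨e, C, h1, h2, h3⟩ := H.exists_three hNE
  refine ⟨N (e 0) + N (e 1) + N (e 2) + 1, ?_, ?_⟩
  · linarith [H.nonneg (e 0), H.nonneg (e 1), H.nonneg (e 2)]
  intro T
  have hX := H.fin T
  have := H.doubling_of_three e C h1 h2 h3 hX.toFinset
  rw [Set.ncard_eq_toFinset_card _ hX, Set.ncard_eq_toFinset_card _ (H.fin _)]
  refine this.trans (Finset.card_le_card ?_)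
  intro z hz
  simp only [Finset.mem_biUnion, Set.Finite.mem_toFinset, Finset.mem_image, Set.mem_ofPred_eq] at hz ⊢
  obtain ⟨x, hx, i, -, rfl⟩ := hz
  have h4 := H.mul_le x (e i)
  have h5 : N (e i) ≤ N (e 0) + N (e 1) + N (e 2) := by
    have := H.nonneg (e 0)
    have := H.nonneg (e 1)
    have := H.nonneg (e 2)
    fin_cases i <;> simp only [Fin.zero_eta, Fin.mk_one, Fin.reduceFinMk] <;> linarith
  linarith

lemma doubling_pow (H : HLen N δ K) (M : ℝ)
    (hM : ∀ T : ℝ, 2 * {g : Γ | N g < T}.ncard ≤ {g : Γ | N g < T + M}.ncard) (T : ℝ) (j : ℕ) :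
    2 ^ j * {g : Γ | N g < T}.ncard ≤ {g : Γ | N g < T + j * M}.ncard := by
  induction j with
  | zero => simp
  | succ j ih =>
    have := hM (T + j * M)
    rw [pow_succ']
    rw [show T + ((j + 1 : ℕ) : ℝ) * M = T + j * M + M by push_cast; ring]
    calc _ = 2 * (2 ^ j * {g : Γ | N g < T}.ncard) := by ring
      _ ≤ _ := by omega

/-- Elements with large backtracking are rare. -/
lemma rare (H : HLen N δ K) : ∃ P : ℕ, ∀ R T : ℝ, 0 ≤ R → 3 * R ≤ T →
    {g : Γ | N g < T ∧ R ≤ gp N g g⁻¹}.ncard ≤ P * {g : Γ | N g < T - R + 2 * K}.ncard := by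
  classical
  have hδ := H.δpos
  have hK := H.Kpos
  set ρ := 6 * K + 6 * δ + 1 with hρ
  refine ⟨{g : Γ | N g < ρ}.ncard + 1, ?_⟩
  intro R T hR hT
  have hex : ∀ g : Γ, ∃ a : Γ, 2 * R ≤ N g → |N a - R| ≤ K ∧ N a + N (a⁻¹ * g) ≤ N g + K := by
    intro g
    by_cases h : 2 * R ≤ N g
    · obtain ⟨a, ha⟩ := H.geo g R hR (by linarith)
      exact ⟨a, fun _ => ha⟩
    · exact ⟨1, fun h' => absurd h' h⟩
  choose a ha using hex
  have hF : {g : Γ | N g < T ∧ R ≤ gp N g g⁻¹}.Finite := (H.fin T).subset (fun g hg => hg.1)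
  set F := hF.toFinset with hFdef
  set B := (H.fin (T - R + 2 * K)).toFinset with hB
  set U := (H.fin ρ).toFinset with hU
  rw [Set.ncard_eq_toFinset_card _ hF, Set.ncard_eq_toFinset_card _ (H.fin (T - R + 2 * K)),
    Set.ncard_eq_toFinset_card _ (H.fin ρ), ← hFdef, ← hB, ← hU]
  have hsplit := Finset.card_filter_add_card_filter_not (s := F) (fun g => 2 * R ≤ N g)
  have hsmall : (F.filter fun g => ¬ 2 * R ≤ N g).card ≤ B.card := by
    apply Finset.card_le_card
    intro g hg
    simp only [Finset.mem_filter, not_le] at hg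
    simp only [hB, Set.Finite.mem_toFinset, Set.mem_ofPred_eq]
    linarith [hg.2]
  have hbig : (F.filter fun g => 2 * R ≤ N g).card ≤ U.card * B.card := by
    apply Finset.card_le_mul_card_image_of_maps_to (f := fun g => (a g)⁻¹ * g)
    · intro g hg
      simp only [Finset.mem_filter, hFdef, Set.Finite.mem_toFinset, Set.mem_ofPred_eq] at hg
      simp only [hB, Set.Finite.mem_toFinset, Set.mem_ofPred_eq]
      obtain ⟨h1, h2⟩ := ha g hg.2
      rw [abs_le] at h1
      linarith [hg.1.1]
    · intro k hk
      have main : ∀ g ∈ (F.filter fun g => 2 * R ≤ N g).filter (fun g => (a g)⁻¹ * g = k),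
          N (a g) ≤ R + K ∧ R - 2 * K - 2 * δ ≤ gp N (a g) k⁻¹ ∧ g = a g * k := by
        intro g hg
        simp only [Finset.mem_filter, hFdef, Set.Finite.mem_toFinset, Set.mem_ofPred_eq] at hg
        obtain ⟨⟨⟨g1, g2⟩, g3⟩, g4⟩ := hg
        obtain ⟨h1, h2⟩ := ha g g3
        rw [abs_le] at h1
        have hk' := H.mul_le (a g) ((a g)⁻¹ * g)
        rw [mul_inv_cancel_left] at hk'
        rw [g4] at h2 hk'
        have g5 : g = a g * k := by rw [← g4, mul_inv_cancel_left]
        refine ⟨by linarith, ?_, g5⟩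
        have q1 : R - 2 * K ≤ gp N (a g) g := by
          unfold gp; rw [g4]; linarith
        have q2 : R - 2 * K ≤ gp N g g⁻¹ := by linarith
        have q3 : R - 2 * K - δ ≤ gp N g⁻¹ k⁻¹ := by
          unfold gp
          rw [inv_inv, show g * k⁻¹ = a g by rw [mul_inv_eq_iff_eq_mul]; exact g5, H.inv, H.inv]
          linarith
        have := H.hyp_lower (H.hyp_lower q1 q2) q3
        linarith
      rcases Finset.eq_empty_or_nonempty
        ((F.filter fun g => 2 * R ≤ N g).filter (fun g => (a g)⁻¹ * g = k)) with h0 | ⟨g₀, hg₀⟩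
      · rw [h0]; simp
      · obtain ⟨m1, m2, m3⟩ := main g₀ hg₀
        apply Finset.card_le_card_of_injOn (fun g => (a g₀)⁻¹ * a g)
        · intro g hg
          obtain ⟨n1, n2, n3⟩ := main g hg
          simp only [hU, Finset.mem_coe, Set.Finite.mem_toFinset, Set.mem_ofPred_eq]
          rw [H.gp_symm] at n2
          have := H.hyp_lower m2 n2
          unfold gp at this
          linarith
        · intro g hg g' hg' heq
          obtain ⟨-, -, n3⟩ := main g hg
          obtain ⟨-, -, n4⟩ := main g' hg'
          have := mul_left_cancel heq
          rw [n3, n4, this]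
  rw [← hsplit, add_mul, one_mul]
  exact add_le_add hbig hsmall

lemma rare_tendsto (H : HLen N δ K) (hNE : NonElementary Γ) :
    ∀ ε > (0:ℝ), ∃ R ≥ (0:ℝ), ∀ T : ℝ, 3 * R ≤ T →
    ({g : Γ | N g < T ∧ R ≤ gp N g g⁻¹}.ncard : ℝ) ≤ ε * {g : Γ | N g < T}.ncard := by
  intro ε hε
  obtain ⟨M, hM0, hM⟩ := H.doubling hNE
  obtain ⟨P, hP⟩ := H.rare
  obtain ⟨j, hj⟩ := pow_unbounded_of_one_lt (P / ε) (one_lt_two (α := ℝ))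
  rw [div_lt_iff₀ hε] at hj
  have hK := H.Kpos
  refine ⟨2 * K + j * M, by positivity, ?_⟩
  intro T hT
  have h1 := hP (2 * K + j * M) T (by positivity) hT
  have h2 := H.doubling_pow M hM (T - (2 * K + j * M) + 2 * K) j
  rw [show T - (2 * K + j * M) + 2 * K + j * M = T by ring] at h2
  set b := {g : Γ | N g < T - (2 * K + j * M) + 2 * K}.ncard
  have h1' : ({g : Γ | N g < T ∧ 2 * K + j * M ≤ gp N g g⁻¹}.ncard : ℝ) ≤ P * b := by exact_mod_cast h1
  have h2' : (2 : ℝ) ^ j * b ≤ {g : Γ | N g < T}.ncard := by exact_mod_cast h2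
  calc _ ≤ (P : ℝ) * b := h1'
    _ ≤ (2 ^ j * ε) * b := mul_le_mul_of_nonneg_right hj.le (Nat.cast_nonneg _)
    _ = ε * (2 ^ j * b) := by ring
    _ ≤ _ := mul_le_mul_of_nonneg_left h2' hε.le

/-- The translation length is close to the length, up to the backtracking. -/
lemma translation (H : HLen N δ K) (g : Γ) :
    |N g - limUnder atTop fun n : ℕ => N (g ^ n) / n| ≤ 2 * gp N g g⁻¹ + 2 * δ := by
  have hδ := H.δpos
  have hsub : Subadditive fun n : ℕ => N (g ^ n) := by
    intro m n
    simp only [pow_add]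
    exact H.mul_le _ _
  have hbdd : BddBelow (Set.range fun n : ℕ => N (g ^ n) / n) :=
    ⟨0, by rintro _ ⟨n, rfl⟩; exact div_nonneg (H.nonneg _) (Nat.cast_nonneg _)⟩
  have hlim := hsub.tendsto_lim hbdd
  rw [hlim.limUnder_eq]
  have e : gp N g g⁻¹ = (2 * N g - N (g ^ 2)) / 2 := by
    unfold gp
    rw [← mul_inv_rev, H.inv, H.inv, ← pow_two]; ring
  have h1 : hsub.lim ≤ N g := by
    have := hsub.lim_le_div hbdd one_ne_zero
    simpa using this
  have h2 : N (g ^ 2) - N g - 2 * δ ≤ hsub.lim := by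
    refine ge_of_tendsto hlim ?_
    filter_upwards [eventually_gt_atTop 0] with n hn
    rw [le_div_iff₀ (by exact_mod_cast hn), mul_comm]
    exact H.pow_lower g n
  rw [abs_le, e]
  constructor <;> linarith [H.gp_nonneg g g⁻¹]

end HLen

lemma wordLength_le (S : Set Γ) (l : List Γ) (hl : ∀ x ∈ l, x ∈ S ∪ S⁻¹) :
    wordLength S l.prod ≤ l.length := Nat.sInf_le ⟨l, rfl, hl, rfl⟩

lemma exists_word {S : Set Γ} (hS : Subgroup.closure S = ⊤) (g : Γ) :
    ∃ l : List Γ, l.length = wordLength S g ∧ (∀ x ∈ l, x ∈ S ∪ S⁻¹) ∧ l.prod = g := by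
  have hne : {n : ℕ | ∃ l : List Γ, l.length = n ∧ (∀ x ∈ l, x ∈ S ∪ S⁻¹) ∧ l.prod = g}.Nonempty := by
    have hg : g ∈ (Subgroup.closure S).toSubmonoid := by rw [hS]; trivial
    rw [Subgroup.closure_toSubmonoid] at hg
    obtain ⟨l, hl, hp⟩ := Submonoid.exists_list_of_mem_closure hg
    exact ⟨l.length, l, rfl, hl, hp⟩
  exact Nat.sInf_mem hne

lemma exists_wordPath {S : Set Γ} (hS : Subgroup.closure S = ⊤) (g : Γ) :
    ∃ (n : ℕ) (x : ℕ → Γ), x 0 = 1 ∧ x n = g ∧ (∀ i, wordDist S (x i) (x (i + 1)) ≤ 1) ∧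
      ∀ i j, i ≤ j → j ≤ n → ((j : ℝ) - i) ≤ wordDist S (x i) (x j) := by
  obtain ⟨l, hl1, hl2, hl3⟩ := exists_word hS g
  refine ⟨l.length, fun i => (l.take i).prod, by simp, by simp [hl3], ?_, ?_⟩
  · intro i
    unfold wordDist
    by_cases hi : i < l.length
    · have e : (l.take i).prod⁻¹ * (l.take (i + 1)).prod = [l[i]].prod := by
        rw [List.prod_take_succ l i hi]; simp
      rw [e]
      have := wordLength_le S [l[i]] (by
        intro x hx
        rw [List.mem_singleton] at hx
        subst hx
        exact hl2 _ (List.getElem_mem hi))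
      simp only [List.length_singleton] at this
      exact_mod_cast this
    · have e : (l.take i).prod⁻¹ * (l.take (i + 1)).prod = ([] : List Γ).prod := by
        rw [List.take_of_length_le (by omega), List.take_of_length_le (by omega)]; simp
      rw [e]
      have := wordLength_le S [] (by simp)
      simp only [List.length_nil] at this
      have h2 : (wordLength S ([] : List Γ).prod : ℝ) ≤ ((0 : ℕ) : ℝ) := by exact_mod_cast this
      push_cast at h2
      linarith
  · intro i j hij hj
    unfold wordDist
    obtain ⟨w, hw1, hw2, hw3⟩ := exists_word hS ((l.take i).prod⁻¹ * (l.take j).prod)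
    rw [← hw1]
    have h1 := wordLength_le S (l.take i ++ w ++ l.drop j) (by
      intro x hx
      simp only [List.mem_append] at hx
      rcases hx with (hx | hx) | hx
      · exact hl2 _ (List.mem_of_mem_take hx)
      · exact hw2 _ hx
      · exact hl2 _ (List.mem_of_mem_drop hx))
    have e : (l.take i ++ w ++ l.drop j).prod = g := by
      rw [List.prod_append, List.prod_append, hw3, mul_inv_cancel_left, List.prod_take_mul_prod_drop, hl3]
    rw [e, ← hl1] at h1
    simp only [List.length_append, List.length_take, List.length_drop] at h1
    have h2 : j ≤ i + w.length := by omega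
    have h3 : (j : ℝ) ≤ i + w.length := by exact_mod_cast h2
    linarith

lemma finite_wordBall {S : Set Γ} (hS : GeneratingSet S) (n : ℕ) : {g : Γ | wordLength S g ≤ n}.Finite := by
  have hfin : (S ∪ S⁻¹).Finite := hS.1.union hS.1.inv
  have : Finite (S ∪ S⁻¹ : Set Γ) := hfin
  have h1 := List.finite_length_le (S ∪ S⁻¹ : Set Γ) n
  refine (h1.image (fun l => (l.map Subtype.val).prod)).subset ?_
  intro g hg
  obtain ⟨l, hl1, hl2, hl3⟩ := exists_word hS.2 g
  refine ⟨l.attach.map (fun x => ⟨x.1, hl2 x.1 x.2⟩), ?_, ?_⟩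
  · have hg' : wordLength S g ≤ n := hg
    simp only [Set.mem_ofPred_eq, List.length_map, List.length_attach]
    omega
  · simp [List.map_map, Function.comp_def, hl3]

/-- Exponential decay of mixed second differences bounds backtracking. -/
lemma sum_bound (F : ℕ → ℕ → ℝ) (A r : ℝ) (hA : 0 ≤ A) (hr0 : 0 < r) (hr1 : r < 1) (n : ℕ)
    (hF : ∀ j k, j < k → k < n →
      |F j k - F (j + 1) k - F j (k + 1) + F (j + 1) (k + 1)| ≤ A * r ^ (k - j))
    (i : ℕ) (hi : i ≤ n) : F 0 i + F i n - F i i - F 0 n ≤ A / (1 - r) ^ 2 := by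
  have h1r : 0 < 1 - r := by linarith
  have c1 : ∀ p j, i = j + 1 + p → ∀ m, i + m ≤ n →
      (F j i - F (j + 1) i) - (F j (i + m) - F (j + 1) (i + m)) ≤
        A * r ^ p / (1 - r) * (1 - r ^ m) := by
    intro p j hj m
    induction m with
    | zero => intro _; simp
    | succ m ih =>
      intro hm
      have h1 := ih (by omega)
      have h2 := (abs_le.1 (hF j (i + m) (by omega) (by omega))).2
      have h3 : i + m - j = p + m + 1 := by omega
      rw [h3] at h2
      have h4 : A * r ^ (p + m + 1) ≤ A * r ^ (p + m) :=
        mul_le_mul_of_nonneg_left (pow_le_pow_of_le_one hr0.le hr1.le (by omega)) hA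
      have h5 : A * r ^ p / (1 - r) * (1 - r ^ (m + 1)) =
          A * r ^ p / (1 - r) * (1 - r ^ m) + A * r ^ (p + m) := by
        field_simp; ring
      rw [h5, ← add_assoc]
      linarith
  have c2 : ∀ q j, i = j + q →
      (F j i - F i i) - (F j n - F i n) ≤ A / (1 - r) ^ 2 * (1 - r ^ q) := by
    intro q
    induction q with
    | zero => intro j hj; subst hj; simp
    | succ q ih =>
      intro j hj
      have h1 := ih (j + 1) (by omega)
      have h2 := c1 q j (by omega) (n - i) (by omega)
      rw [show i + (n - i) = n by omega] at h2
      have h3 : A * r ^ q / (1 - r) * (1 - r ^ (n - i)) ≤ A * r ^ q / (1 - r) * 1 := by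
        apply mul_le_mul_of_nonneg_left
        · have := pow_pos hr0 (n - i); linarith
        · positivity
      have h5 : A / (1 - r) ^ 2 * (1 - r ^ (q + 1)) =
          A / (1 - r) ^ 2 * (1 - r ^ q) + A * r ^ q / (1 - r) * 1 := by
        field_simp; ring
      rw [h5]
      linarith
  have h1 := c2 i 0 (by omega)
  have h2 : A / (1 - r) ^ 2 * (1 - r ^ i) ≤ A / (1 - r) ^ 2 * 1 := by
    apply mul_le_mul_of_nonneg_left
    · have := pow_pos hr0 i; linarith
    · positivity
  linarith

lemma exists_HLen (d : Γ → Γ → ℝ) (hd : MemD d) (hs : StronglyHyperbolic d) :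
    ∃ δ K, HLen (d 1) δ K := by
  obtain ⟨⟨hrefl, hpos, hsymm, htri⟩, hinv, ⟨δ, hδ0, hδ⟩, S, hS, L, hL, C, hC, hQ⟩ := hd
  obtain ⟨c, hc, R₀, hR₀, hs⟩ := hs
  have hd1 : ∀ x y, d x y = d 1 (x⁻¹ * y) := by
    intro x y
    rw [← hinv x⁻¹ x y, inv_mul_cancel]
  have hnn : ∀ x y, 0 ≤ d x y := by
    intro x y
    have := htri x y x
    rw [hrefl, hsymm y x] at this
    linarith
  set C0 := L + C with hC0
  set β := 2 * C + 2 * C0 with hβ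
  set α := 2 * L⁻¹ with hα
  have hLi : 0 < L⁻¹ := inv_pos.2 hL
  have hα0 : 0 < α := by positivity
  set r := Real.exp (-c * α) with hr
  have hr0 : 0 < r := Real.exp_pos _
  have hr1 : r < 1 := by
    rw [hr, Real.exp_lt_one_iff]; nlinarith [mul_pos hc hα0]
  set A := Real.exp (c * β) + 2 * C0 * Real.exp (c * (R₀ + β)) with hA
  have hA0 : 0 ≤ A := by positivity
  set K1 := A / (1 - r) ^ 2 with hK1
  have hK10 : 0 ≤ K1 := by positivity
  have path : ∀ g : Γ, ∃ (n : ℕ) (x : ℕ → Γ), x 0 = 1 ∧ x n = g ∧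
      (∀ i, d (x i) (x (i + 1)) ≤ C0) ∧ ∀ i ≤ n, d 1 (x i) + d (x i) g ≤ d 1 g + K1 := by
    intro g
    obtain ⟨n, x, h0, hn, hx1, hx2⟩ := exists_wordPath hS.2 g
    have hstep : ∀ i, d (x i) (x (i + 1)) ≤ C0 := by
      intro i
      have h1 := (hQ (x i) (x (i + 1))).2
      have h2 := mul_le_mul_of_nonneg_left (hx1 i) hL.le
      rw [hC0]; linarith
    refine ⟨n, x, h0, hn, hstep, ?_⟩
    intro i hi
    have hsum := sum_bound (fun j k => d (x j) (x k)) A r hA0 hr0 hr1 n ?_ i hi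
    · simp only [h0, hn, hrefl] at hsum
      linarith
    intro j k hjk hk
    have hlow : ∀ j k, j ≤ k → k ≤ n → L⁻¹ * ((k : ℝ) - j) - C ≤ d (x j) (x k) := by
      intro j k hjk hk
      have h1 := (hQ (x j) (x k)).1
      have h2 := mul_le_mul_of_nonneg_left (hx2 j k hjk hk) hLi.le
      linarith
    have l1 := hlow j k (by omega) (by omega)
    have l2 := hlow (j + 1) (k + 1) (by omega) (by omega)
    have hexp : r ^ (k - j) = Real.exp (-c * α * ((k : ℝ) - j)) := by
      rw [hr, ← Real.exp_nat_mul, Nat.cast_sub hjk.le]; ring_nf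
    rw [hexp]
    have hcond : α * ((k : ℝ) - j) - β ≤
        d (x j) (x k) - d (x j) (x (j + 1)) + d (x (j + 1)) (x (k + 1)) - d (x k) (x (k + 1)) := by
      have s1 := hstep j
      have s2 := hstep k
      push_cast at l2
      rw [hα, hβ]
      linarith
    by_cases hR : R₀ ≤ α * ((k : ℝ) - j) - β
    · have h1 := hs _ hR (x j) (x (j + 1)) (x k) (x (k + 1)) hcond
      refine h1.trans ?_
      have e : Real.exp (-c * (α * ((k : ℝ) - j) - β)) =
          Real.exp (c * β) * Real.exp (-c * α * ((k : ℝ) - j)) := by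
        rw [← Real.exp_add]; ring_nf
      rw [e]
      apply mul_le_mul_of_nonneg_right _ (Real.exp_pos _).le
      rw [hA]
      have : 0 ≤ 2 * C0 * Real.exp (c * (R₀ + β)) := by positivity
      linarith
    · push Not at hR
      have t1 := htri (x j) (x (j + 1)) (x k)
      have t2 := htri (x (j + 1)) (x j) (x k)
      have t3 := htri (x j) (x (j + 1)) (x (k + 1))
      have t4 := htri (x (j + 1)) (x j) (x (k + 1))
      rw [hsymm (x (j + 1)) (x j)] at t2 t4
      have s1 := hstep j
      have h1 : |d (x j) (x k) - d (x (j + 1)) (x k) - d (x j) (x (k + 1)) + d (x (j + 1)) (x (k + 1))|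
          ≤ 2 * C0 := by
        rw [abs_le]; constructor <;> linarith
      refine h1.trans ?_
      have h2 : 1 ≤ Real.exp (c * (R₀ + β)) * Real.exp (-c * α * ((k : ℝ) - j)) := by
        rw [← Real.exp_add]
        apply Real.one_le_exp
        nlinarith
      have hC00 : 0 ≤ 2 * C0 := by positivity
      calc 2 * C0 = 2 * C0 * 1 := by ring
        _ ≤ 2 * C0 * (Real.exp (c * (R₀ + β)) * Real.exp (-c * α * ((k : ℝ) - j))) :=
          mul_le_mul_of_nonneg_left h2 hC00
        _ = (2 * C0 * Real.exp (c * (R₀ + β))) * Real.exp (-c * α * ((k : ℝ) - j)) := by ring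
        _ ≤ _ := by
          apply mul_le_mul_of_nonneg_right _ (Real.exp_pos _).le
          rw [hA]
          have : 0 ≤ Real.exp (c * β) := (Real.exp_pos _).le
          linarith
  have hgp : ∀ x y, gromov d 1 x y = gp (d 1) x y := by
    intro x y
    unfold gromov gp
    rw [hd1 x y]
  have hginv : ∀ x, d 1 x⁻¹ = d 1 x := by
    intro x
    rw [hsymm 1 x, hd1 x 1, mul_one]
  refine ⟨δ + 1, C0 + K1, hrefl 1, hginv, ?_, by linarith, by positivity, ?_, ?_, ?_⟩
  · intro x y
    have h1 := htri 1 x (x * y)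
    rw [hd1 x (x * y), inv_mul_cancel_left] at h1
    exact h1
  · intro x y z
    have h1 := hδ x y z 1
    rw [hgp, hgp, hgp] at h1
    have e : gp (d 1) z y = gp (d 1) y z := by
      rw [← hgp, ← hgp]; unfold gromov; rw [hsymm z y]; ring
    rw [e]; linarith
  · intro T
    obtain ⟨n, hn⟩ := exists_nat_gt (L * (T + C))
    refine (finite_wordBall hS n).subset ?_
    intro g hg
    have hg' : d 1 g < T := hg
    have h1 := (hQ 1 g).1
    have h2 : L⁻¹ * wordDist S 1 g < T + C := by linarith
    rw [inv_mul_lt_iff₀ hL] at h2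
    have h3 : (wordLength S g : ℝ) < n := by
      unfold wordDist at h2
      rw [inv_one, one_mul] at h2
      linarith
    have h4 : wordLength S g < n := by exact_mod_cast h3
    exact h4.le
  · intro g t ht0 ht
    obtain ⟨n, x, h0, hn, hst, hx⟩ := path g
    obtain ⟨i, hi, h1, h2⟩ := HLen.divt (fun i => d 1 (x i)) C0 (by positivity) n (by simp [h0, hrefl])
      (by
        intro i _
        have t1 := htri 1 (x i) (x (i + 1))
        have t2 := htri 1 (x (i + 1)) (x i)
        rw [hsymm (x (i + 1)) (x i)] at t2
        have := hst i
        rw [abs_le]; constructor <;> linarith) t ht0 (by simpa [hn] using ht)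
    refine ⟨x i, ?_, ?_⟩
    · rw [abs_le]; constructor <;> linarith
    · have := hx i hi
      rw [hd1 (x i) g] at this
      have : 0 ≤ C0 := by positivity
      linarith

/-- **Lemma 4.1.** For a strongly hyperbolic metric, most elements in a ball have
displacement close to their translation length. -/
theorem displacement_close_to_translation_length
    (hΓ : IsHyperbolicGroup Γ) (hNE : NonElementary Γ)
    (d : Γ → Γ → ℝ) (hd : MemD d) (hshd : StronglyHyperbolic d) :
    Tendsto (fun T : ℝ =>
        (({g : Γ | d 1 g < T ∧ T ^ ((1:ℝ)/3) < |d 1 g - translationLength d g|}).ncard : ℝ) /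
          (((ball d T).ncard : ℝ)))
      atTop (nhds 0) := by
  obtain ⟨δ, K, H⟩ := exists_HLen d hd hshd
  rw [Metric.tendsto_nhds]
  intro ε hε
  obtain ⟨R, hR0, hR⟩ := H.rare_tendsto hNE (ε / 2) (by linarith)
  have hT : Tendsto (fun T : ℝ => T ^ ((1:ℝ)/3)) atTop atTop := tendsto_rpow_atTop (by norm_num)
  filter_upwards [hT.eventually_ge_atTop (2 * R + 2 * δ), eventually_ge_atTop (3 * R),
    eventually_gt_atTop 0] with T h1 h2 h3
  have hb : (0:ℝ) < ((ball d T).ncard : ℝ) := by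
    have : 0 < (ball d T).ncard := by
      rw [show ball d T = {g : Γ | d 1 g < T} from rfl, Set.ncard_pos (H.fin T)]
      exact ⟨1, by show d 1 1 < T; rw [H.one]; exact h3⟩
    exact_mod_cast this
  have hle : ({g : Γ | d 1 g < T ∧ T ^ ((1:ℝ)/3) < |d 1 g - translationLength d g|}).ncard ≤
      {g : Γ | d 1 g < T ∧ R ≤ gp (d 1) g g⁻¹}.ncard := by
    apply Set.ncard_le_ncard _ ((H.fin T).subset (fun g hg => hg.1))
    rintro g ⟨g1, g2⟩
    refine ⟨g1, ?_⟩
    have := H.translation g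
    unfold translationLength at g2
    linarith
  have hle' : (({g : Γ | d 1 g < T ∧ T ^ ((1:ℝ)/3) < |d 1 g - translationLength d g|}).ncard : ℝ) ≤
      ε / 2 * (ball d T).ncard := (Nat.cast_le.2 hle).trans (hR T h2)
  rw [Real.dist_eq, sub_zero, abs_of_nonneg (by positivity), div_lt_iff₀ hb]
  have : 0 < ε / 2 * ((ball d T).ncard : ℝ) := by positivity
  linarith

end PaperCLT
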